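/- Common shutdown sequence: let (N,μ₀) be a perpetual free-choice system with regeneration cluster cl, let N̂ ⊆ N be a cl-adapted CP-subnet, and let (μ₁,μ₂) be reachable markings of (N,μ₀) whose restrictions to the places of N̂ are enabling equivalent, en(N̂,μ₁|N̂) = en(N̂,μ₂|N̂). Then every shutdown sequence σ for N̂ at μ₁ is also a shutdown sequence for N̂ at μ₂. -/

import Mathlib

open Classical

/-- A (finite, bipartite) Petri *net*: disjoint finite sets of places and
transitions, and an edge relation running only between places and transitions. -/
structure Net (α : Type*) where
  places : Finset α
  transitions : Finset α
  F : α → α → Prop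
  disj : Disjoint places transitions
  edges : ∀ x y, F x y →
    (x ∈ places ∧ y ∈ transitions) ∨ (x ∈ transitions ∧ y ∈ places)

namespace Net

variable {α : Type*} [DecidableEq α]

/-- The nodes of a net. -/
def nodes (N : Net α) : Finset α := N.places ∪ N.transitions

/-- Pre-set of a node. -/
def pre (N : Net α) (x : α) : Set α := {y | N.F y x}

/-- Post-set of a node. -/
def post (N : Net α) (x : α) : Set α := {y | N.F x y}

/-- A transition `t` is enabled at a marking `μ` if every pre-place is marked. -/
def Enabled (N : Net α) (μ : α → ℕ) (t : α) : Prop :=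
  t ∈ N.transitions ∧ ∀ p, N.F p t → 1 ≤ μ p

/-- Firing a transition: remove one token from each pre-place,
add one token at each post-place. -/
noncomputable def fire (N : Net α) (t : α) (μ : α → ℕ) : α → ℕ :=
  fun p => μ p - (if N.F p t then 1 else 0) + (if N.F t p then 1 else 0)

/-- `FireSeq N μ σ ν`: the occurrence sequence `σ` is enabled at `μ` and
firing it successively leads from `μ` to `ν`. -/
inductive FireSeq (N : Net α) : (α → ℕ) → List α → (α → ℕ) → Prop
  | nil (μ : α → ℕ) : FireSeq N μ [] μ
  | cons {μ ν : α → ℕ} {t : α} {σ : List α} :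
      N.Enabled μ t → FireSeq N (N.fire t μ) σ ν → FireSeq N μ (t :: σ) ν

/-- Reachability of markings. -/
def Reach (N : Net α) (μ ν : α → ℕ) : Prop := ∃ σ : List α, N.FireSeq μ σ ν

/-- The set of transitions enabled at `μ`. -/
def en (N : Net α) (μ : α → ℕ) : Set α := {t | N.Enabled μ t}

/-- Equality of markings (as maps on the places of the net). -/
def MarkingEq (N : Net α) (μ ν : α → ℕ) : Prop := ∀ p ∈ N.places, μ p = ν p

/-- Liveness of a Petri net `(N, μ₀)`. -/
def Live (N : Net α) (μ₀ : α → ℕ) : Prop :=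
  ∀ t ∈ N.transitions, ∀ μ, N.Reach μ₀ μ → ∃ ν, N.Reach μ ν ∧ N.Enabled ν t

/-- Boundedness of a Petri net `(N, μ₀)`. -/
def Bounded (N : Net α) (μ₀ : α → ℕ) : Prop :=
  ∃ K : ℕ, ∀ μ, N.Reach μ₀ μ → ∀ p ∈ N.places, μ p ≤ K

/-- A net is well-formed if it carries a live and bounded marking. -/
def WellFormed (N : Net α) : Prop := ∃ μ₀ : α → ℕ, N.Live μ₀ ∧ N.Bounded μ₀

/-- Free-choice net: `(p,t) ∈ F` implies `•t × p• ⊆ F`. -/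
def FreeChoice (N : Net α) : Prop :=
  ∀ p ∈ N.places, ∀ t, N.F p t → ∀ p', N.F p' t → ∀ t', N.F p t' → N.F p' t'

/-- T-net: every place has exactly one pre-transition and one post-transition. -/
def IsTNet (N : Net α) : Prop :=
  ∀ p ∈ N.places, (∃! t, N.F t p) ∧ (∃! t, N.F p t)

/-- A set of nodes is cluster-closed if with each place it contains the
post-set of the place and with each transition the pre-set of the transition. -/
def ClusterClosed (N : Net α) (S : Set α) : Prop :=
  (∀ p ∈ S, p ∈ N.places → ∀ t, N.F p t → t ∈ S) ∧
  (∀ t ∈ S, t ∈ N.transitions → ∀ p, N.F p t → p ∈ S)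

/-- The cluster of a node: the smallest cluster-closed set of nodes containing it. -/
def clusterOf (N : Net α) (x : α) : Set α :=
  ⋂₀ {S : Set α | x ∈ S ∧ N.ClusterClosed S}

/-- `cl` is a cluster of `N` if it is the cluster of some node. -/
def IsCluster (N : Net α) (cl : Set α) : Prop :=
  ∃ x ∈ N.nodes, cl = N.clusterOf x

/-- The marking `μ_cl` marking exactly the places of the cluster `cl`, once. -/
noncomputable def clusterMarking (N : Net α) (cl : Set α) : α → ℕ :=
  fun p => if p ∈ cl ∧ p ∈ N.places then 1 else 0

/-- `μh` is a home marking of `(N, μ₀)`: reachable from every reachable marking. -/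
def IsHomeMarking (N : Net α) (μ₀ μh : α → ℕ) : Prop :=
  ∀ μ, N.Reach μ₀ μ → ∃ ν, N.Reach μ ν ∧ N.MarkingEq ν μh

/-- `(N, μ₀)` is perpetual with regeneration cluster `cl`: live, bounded, and
`μ_cl` is a home marking for the cluster `cl`. -/
def Perpetual (N : Net α) (μ₀ : α → ℕ) (cl : Set α) : Prop :=
  N.Live μ₀ ∧ N.Bounded μ₀ ∧ N.IsCluster cl ∧
    N.IsHomeMarking μ₀ (N.clusterMarking cl)

/-- Lucency: enabling-equivalent reachable markings are equal. -/
def Lucent (N : Net α) (μ₀ : α → ℕ) : Prop :=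
  ∀ μ₁ μ₂, N.Reach μ₀ μ₁ → N.Reach μ₀ μ₂ → N.en μ₁ = N.en μ₂ → N.MarkingEq μ₁ μ₂

/-- A path of the net: a nonempty sequence of nodes along edges. -/
def IsPath (N : Net α) (δ : List α) : Prop :=
  δ ≠ [] ∧ (∀ x ∈ δ, x ∈ N.nodes) ∧ δ.Chain' N.F

/-- A circuit: a path whose last node is connected back to its first node. -/
def IsCircuit (N : Net α) (δ : List α) : Prop :=
  N.IsPath δ ∧ ∃ h : δ ≠ [], N.F (δ.getLast h) (δ.head h)

/-- Token count of a set of nodes: total number of tokens on its places. -/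
def tokenCount (N : Net α) (μ : α → ℕ) (X : Finset α) : ℕ :=
  ∑ p ∈ X ∩ N.places, μ p

/-- The set `S` of nodes is strongly connected (in the induced subnet). -/
def StronglyConnectedOn (N : Net α) (S : Finset α) : Prop :=
  ∀ x ∈ S, ∀ y ∈ S,
    Relation.ReflTransGen (fun a b => a ∈ S ∧ b ∈ S ∧ N.F a b) x y

/-- The set `S` of nodes is weakly connected (in the induced subnet). -/
def WeaklyConnectedOn (N : Net α) (S : Finset α) : Prop :=
  ∀ x ∈ S, ∀ y ∈ S,
    Relation.ReflTransGen (fun a b => a ∈ S ∧ b ∈ S ∧ (N.F a b ∨ N.F b a)) x y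

/-- The (full) subnet spanned by `S` is transition-bordered: every place of `S`
has all its neighbours inside `S`. -/
def TransitionBordered (N : Net α) (S : Finset α) : Prop :=
  ∀ p ∈ S, p ∈ N.places → ∀ y, (N.F y p ∨ N.F p y) → y ∈ S

/-- The full subnet spanned by `S` is a T-net: each place of `S` has exactly one
pre-transition and one post-transition inside `S`. -/
def TNetOn (N : Net α) (S : Finset α) : Prop :=
  ∀ p ∈ S, p ∈ N.places →
    (∃! t, t ∈ S ∧ N.F t p) ∧ (∃! t, t ∈ S ∧ N.F p t)

/-- `S` spans a CP-subnet of `N`: nonempty, weakly connected, transition-bordered,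
a T-net, and the complement contains a transition and is strongly connected. -/
def IsCPSubnet (N : Net α) (S : Finset α) : Prop :=
  S.Nonempty ∧ S ⊆ N.nodes ∧ N.WeaklyConnectedOn S ∧ N.TransitionBordered S ∧
  N.TNetOn S ∧ ((N.nodes \ S) ∩ N.transitions).Nonempty ∧
  N.StronglyConnectedOn (N.nodes \ S)

/-- The full subnet of `N` spanned by the node set `S`, as a net. -/
def restrict (N : Net α) (S : Finset α) : Net α where
  places := N.places ∩ S
  transitions := N.transitions ∩ S
  F := fun x y => x ∈ S ∧ y ∈ S ∧ N.F x y
  disj := N.disj.mono Finset.inter_subset_left Finset.inter_subset_left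
  edges := by
    rintro x y ⟨hx, hy, hF⟩
    rcases N.edges x y hF with ⟨h1, h2⟩ | ⟨h1, h2⟩
    · exact Or.inl ⟨Finset.mem_inter.mpr ⟨h1, hx⟩, Finset.mem_inter.mpr ⟨h2, hy⟩⟩
    · exact Or.inr ⟨Finset.mem_inter.mpr ⟨h1, hx⟩, Finset.mem_inter.mpr ⟨h2, hy⟩⟩

/-- A CP-exhaustion: a family of pairwise disjoint CP-subnets whose complement
is a strongly connected T-net. -/
def IsCPExhaustion (N : Net α) {n : ℕ}
    (Nhat : Fin n → Finset α) : Prop :=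
  (∀ i, N.IsCPSubnet (Nhat i)) ∧
  (∀ i j, i ≠ j → Disjoint (Nhat i) (Nhat j)) ∧
  N.StronglyConnectedOn (N.nodes \ Finset.univ.biUnion Nhat) ∧
  N.TNetOn (N.nodes \ Finset.univ.biUnion Nhat)

/-- `t` is a way-in transition of the subnet spanned by `S`: a transition of `S`
with a pre-place outside `S`. -/
def IsWayIn (N : Net α) (S : Finset α) (t : α) : Prop :=
  t ∈ S ∧ t ∈ N.transitions ∧ ∃ p ∈ N.places, p ∉ S ∧ N.F p t

/-- A shutdown sequence for the subnet spanned by `S` (with way-in transition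
`tin`) at a marking `μ`: an occurrence sequence enabled at `μ` using only
transitions of `S` other than `tin`, after which no transition of `S` other
than (possibly) `tin` is enabled. -/
def IsShutdownSeq (N : Net α) (S : Finset α) (tin : α)
    (μ : α → ℕ) (σ : List α) (μsd : α → ℕ) : Prop :=
  N.FireSeq μ σ μsd ∧
  (∀ t ∈ σ, t ∈ S ∧ t ∈ N.transitions ∧ t ≠ tin) ∧
  (∀ t ∈ S, t ∈ N.transitions → t ≠ tin → ¬ N.Enabled μsd t)

/-- `C` spans a P-component of `N`: nonempty, strongly connected, inside `C`
every transition has exactly one pre-place and one post-place, and every place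
of `C` has all its neighbours inside `C`. -/
def IsPComponent (N : Net α) (C : Finset α) : Prop :=
  C.Nonempty ∧ C ⊆ N.nodes ∧ N.StronglyConnectedOn C ∧
  (∀ t ∈ C, t ∈ N.transitions →
    (∃! p, p ∈ C ∧ N.F p t) ∧ (∃! p, p ∈ C ∧ N.F t p)) ∧
  (∀ p ∈ C, p ∈ N.places → ∀ y, (N.F y p ∨ N.F p y) → y ∈ C)

end Net

namespace Net

variable {α : Type*} {N : Net α} {μ₀ μ ν ρ : α → ℕ} {σ τ : List α}

theorem place_transition_ne {p t : α} (hp : p ∈ N.places) (ht : t ∈ N.transitions) : p ≠ t :=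
  fun h => Finset.disjoint_left.mp N.disj hp (h ▸ ht)

theorem transition_of_place_F {p t : α} (h : N.F p t) (hp : p ∈ N.places) :
    t ∈ N.transitions := by
  rcases N.edges p t h with h | h
  · exact h.2
  · exact absurd rfl (place_transition_ne hp h.1)

theorem place_of_F_transition {p t : α} (h : N.F p t) (ht : t ∈ N.transitions) :
    p ∈ N.places := by
  rcases N.edges p t h with h | h
  · exact h.1
  · exact absurd rfl (place_transition_ne h.2 ht)

theorem place_of_transition_F {p t : α} (h : N.F t p) (ht : t ∈ N.transitions) :
    p ∈ N.places := by
  rcases N.edges t p h with h | h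
  · exact absurd rfl (place_transition_ne h.1 ht)
  · exact h.2

theorem transition_of_F_place {p t : α} (h : N.F t p) (hp : p ∈ N.places) :
    t ∈ N.transitions := by
  rcases N.edges t p h with h | h
  · exact absurd rfl (place_transition_ne hp h.2)
  · exact h.1

/-! ### Occurrence sequences -/

theorem FireSeq.append (h : N.FireSeq μ σ ν) (h' : N.FireSeq ν τ ρ) :
    N.FireSeq μ (σ ++ τ) ρ := by
  induction h with
  | nil => exact h'
  | cons he _ ih => exact .cons he (ih h')

theorem Enabled.fireSeq {t : α} (h : N.Enabled μ t) : N.FireSeq μ [t] (N.fire t μ) :=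
  .cons h (.nil _)

theorem FireSeq.reach (h : N.FireSeq μ σ ν) : N.Reach μ ν := ⟨σ, h⟩

theorem Reach.trans (h : N.Reach μ ν) (h' : N.Reach ν ρ) : N.Reach μ ρ := by
  obtain ⟨σ, hσ⟩ := h
  obtain ⟨τ, hτ⟩ := h'
  exact ⟨σ ++ τ, hσ.append hτ⟩

theorem FireSeq.mem_transitions (h : N.FireSeq μ σ ν) : ∀ t ∈ σ, t ∈ N.transitions := by
  induction h with
  | nil => simp
  | cons he _ ih => simpa using ⟨he.1, ih⟩

/-- The state equation at a place. -/
theorem FireSeq.state_equation (h : N.FireSeq μ σ ν) (p : α) :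
    ν p + σ.countP (fun t => N.F p t) = μ p + σ.countP (fun t => N.F t p) := by
  induction h with
  | nil => simp
  | @cons μ ν t σ he _ ih =>
    have := he.2 p
    simp only [List.countP_cons, fire, decide_eq_true_eq] at ih ⊢
    split_ifs at ih ⊢ <;> grind

theorem FireSeq.count_le [DecidableEq α] (h : N.FireSeq μ σ ν) {p t u : α}
    (ht : N.F t p)
    (hu : ∀ w ∈ σ, N.F p w → w = u) : σ.count t ≤ σ.count u + ν p := by
  have h1 : σ.count t ≤ σ.countP (fun t => N.F t p) :=
    List.countP_mono_left (by grind)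
  have h2 : σ.countP (fun w => N.F p w) ≤ σ.count u :=
    List.countP_mono_left (by grind)
  have := h.state_equation p
  omega

/-- If, along the sequences firing only transitions in `A`, each transition in `W` fires a bounded
number of times, then some reachable marking allows no transition in `W` to fire
by means of transitions in `A`. -/
theorem exists_reach_stuck [DecidableEq α] (A W : α → Prop)
    (hb : ∀ t ∈ N.transitions, W t → ∃ C : ℕ, ∀ σ ν, N.FireSeq μ₀ σ ν → (∀ w ∈ σ, A w) →
      σ.count t ≤ C) :
    ∃ μ, N.Reach μ₀ μ ∧ ∀ σ ν, N.FireSeq μ σ ν → (∀ w ∈ σ, A w) → ∀ w ∈ σ, ¬ W w := by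
  by_contra! hcon
  have pump : ∀ K : ℕ, ∃ σ ν, N.FireSeq μ₀ σ ν ∧ (∀ w ∈ σ, A w) ∧
      K ≤ σ.countP (fun w => W w) := by
    intro K
    induction K with
    | zero => exact ⟨[], μ₀, .nil _, by simp, by simp⟩
    | succ K ih =>
      obtain ⟨σ, ν, hσ, hA, hK⟩ := ih
      obtain ⟨τ, ρ, hτ, hA', w, hw, hW⟩ := hcon ν hσ.reach
      refine ⟨σ ++ τ, ρ, hσ.append hτ, by grind, ?_⟩
      have : 0 < τ.countP (fun w => W w) := List.countP_pos_iff.mpr ⟨w, hw, by simpa using hW⟩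
      rw [List.countP_append]
      omega
  have hb' : ∀ t, ∃ C : ℕ, t ∈ N.transitions → W t → ∀ σ ν, N.FireSeq μ₀ σ ν →
      (∀ w ∈ σ, A w) → σ.count t ≤ C := by
    intro t
    by_cases h : t ∈ N.transitions ∧ W t
    · obtain ⟨C, hC⟩ := hb t h.1 h.2
      exact ⟨C, fun _ _ => hC⟩
    · exact ⟨0, fun h1 h2 => absurd ⟨h1, h2⟩ h⟩
  choose C hC using hb'
  obtain ⟨σ, ν, hσ, hA, hK⟩ := pump (∑ t ∈ N.transitions, C t + 1)
  have key : σ.countP (fun w => W w) ≤ ∑ t ∈ N.transitions, C t := by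
    have h1 : σ.countP (fun w => W w) = (σ.filter (fun w => W w)).length :=
      List.countP_eq_length_filter
    have h2 : (σ.filter (fun w => W w)).length =
        ∑ t ∈ N.transitions, (σ.filter (fun w => W w)).count t := by
      have := Multiset.sum_count_eq_card (s := N.transitions)
        (m := ((σ.filter (fun w => W w) : List α) : Multiset α))
        (fun a ha => hσ.mem_transitions a (by
          rw [Multiset.mem_coe] at ha
          exact (List.mem_filter.mp ha).1))
      simpa using this.symm
    rw [h1, h2]
    refine Finset.sum_le_sum fun t ht => ?_
    by_cases hW : W t
    · exact (List.filter_sublist.count_le t).trans (hC t ht hW σ ν hσ hA)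
    · rw [List.count_eq_zero_of_not_mem (by simp [hW])]
      exact Nat.zero_le _
  omega

theorem Live.exists_enabled (hl : N.Live μ₀) (hT : N.transitions.Nonempty)
    (h : N.Reach μ₀ μ) : ∃ t, N.Enabled μ t := by
  obtain ⟨t, ht⟩ := hT
  obtain ⟨ν, ⟨σ, hσ⟩, he⟩ := hl t ht μ h
  cases hσ with
  | nil => exact ⟨t, he⟩
  | cons he' _ => exact ⟨_, he'⟩

/-! ### Free-choice nets -/

theorem FreeChoice.F_iff (hfc : N.FreeChoice) {p t p' : α} (hp : p ∈ N.places)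
    (h : N.F p t) (h' : N.F p' t) (u : α) : N.F p u ↔ N.F p' u :=
  ⟨hfc p hp t h p' h' u, hfc p' (place_of_F_transition h' (transition_of_place_F h hp)) t h' p h u⟩

theorem FreeChoice.pre_eq (hfc : N.FreeChoice) {p t u : α} (hp : p ∈ N.places)
    (ht : N.F p t) (hu : N.F p u) : N.pre t = N.pre u := by
  ext p'
  exact ⟨fun h => hfc p hp t ht p' h u hu, fun h => hfc p hp u hu p' h t ht⟩

theorem FreeChoice.post_eq (hfc : N.FreeChoice) {p t p' : α} (hp : p ∈ N.places)
    (h : N.F p t) (h' : N.F p' t) : N.post p = N.post p' :=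
  Set.ext (hfc.F_iff hp h h')

theorem FreeChoice.enabled (hfc : N.FreeChoice) {p t u : α} (hp : p ∈ N.places)
    (ht : N.F p t) (hu : N.F p u) (he : N.Enabled μ t) : N.Enabled μ u :=
  ⟨transition_of_place_F hu hp, fun p' h => he.2 p' (hfc p hp u hu p' h t ht)⟩

theorem IsCluster.subset_or_subset_compl [DecidableEq α] {cl V : Set α}
    (hcl : N.IsCluster cl)
    (hV : N.ClusterClosed V) (hV' : N.ClusterClosed Vᶜ) : cl ⊆ V ∨ cl ⊆ Vᶜ := by
  obtain ⟨x, -, rfl⟩ := hcl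
  by_cases hx : x ∈ V
  · exact Or.inl (Set.sInter_subset_of_mem ⟨hx, hV⟩)
  · exact Or.inr (Set.sInter_subset_of_mem ⟨hx, hV'⟩)

/-- All places of a cluster of a free-choice net have the same output transitions. -/
theorem IsCluster.F_of_F [DecidableEq α] {cl : Set α} (hcl : N.IsCluster cl)
    (hfc : N.FreeChoice) {p q t : α}
    (hp : p ∈ cl) (hq : q ∈ cl) (hpP : p ∈ N.places) (hqP : q ∈ N.places) (h : N.F p t) :
    N.F q t := by
  have htT := transition_of_place_F h hpP
  have key := hcl.subset_or_subset_compl (V := {x | N.F x t ∨ N.F p x})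
    ⟨fun x hx hxP u hu => ?_, fun x hx hxT u hu => ?_⟩
    ⟨fun x hx hxP u hu hmem => ?_, fun x hx hxT u hu hmem => ?_⟩
  · rcases key with hsub | hsub
    · rcases hsub hq with h' | h'
      · exact h'
      · exact absurd rfl (place_transition_ne hqP (transition_of_place_F h' hpP))
    · exact absurd (Or.inl h) (hsub hp)
  · rcases hx with hx | hx
    · exact Or.inr (hfc x hxP t hx p h u hu)
    · exact absurd rfl (place_transition_ne hxP (transition_of_place_F hx hpP))
  · rcases hx with hx | hx
    · exact absurd rfl (place_transition_ne (place_of_F_transition hx htT) hxT)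
    · exact Or.inl (hfc p hpP x hx u hu t h)
  · rcases hmem with hu' | hu'
    · exact absurd rfl (place_transition_ne (place_of_F_transition hu' htT)
        (transition_of_place_F hu hxP))
    · exact hx (Or.inl (hfc p hpP u hu' x hu t h))
  · rcases hmem with hu' | hu'
    · exact hx (Or.inr (hfc u (place_of_F_transition hu hxT) t hu' p h x hu))
    · exact absurd rfl (place_transition_ne (place_of_F_transition hu hxT)
        (transition_of_place_F hu' hpP))

/-! ### Siphons -/

/-- A siphon: a set of places whose input transitions are among its output transitions. -/
def IsSiphon (N : Net α) (Q : Set α) : Prop :=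
  (∀ q ∈ Q, q ∈ N.places) ∧ ∀ q ∈ Q, ∀ t, N.F t q → ∃ q' ∈ Q, N.F q' t

theorem IsSiphon.unmarked {Q : Set α} (hQ : N.IsSiphon Q) (h : N.FireSeq μ σ ν)
    (h0 : ∀ q ∈ Q, μ q = 0) : ∀ q ∈ Q, ν q = 0 := by
  induction h with
  | nil => exact h0
  | @cons μ ν t σ he _ ih =>
    refine ih fun q hq => ?_
    have hnt : ¬ N.F t q := by
      intro hF
      obtain ⟨q', hq', hF'⟩ := hQ.2 q hq t hF
      have := he.2 q' hF'
      have := h0 q' hq'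
      omega
    simp [fire, h0 q hq, hnt]

/-- A siphon with an output transition is marked at every reachable marking of a live net. -/
theorem IsSiphon.exists_marked {Q : Set α} (hQ : N.IsSiphon Q) (hl : N.Live μ₀)
    (h : N.Reach μ₀ μ) {q t : α} (hq : q ∈ Q) (hF : N.F q t) : ∃ q ∈ Q, 0 < μ q := by
  by_contra! hcon
  obtain ⟨ν, ⟨σ, hσ⟩, he⟩ := hl t (transition_of_place_F hF (hQ.1 q hq)) μ h
  have := hQ.unmarked hσ (fun q hq => Nat.le_zero.mp (hcon q hq)) q hq
  have := he.2 q hF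
  omega

/-! ### Allocations -/

/-- Starting in a set `X` of transitions, the target `u` can be reached in `n` steps
leading through the places in `P` and the transitions in `T`. -/
def Leads (N : Net α) (P T : Set α) (u : α) : ℕ → Set α → Prop
  | 0, X => u ∈ X
  | n + 1, X => ∃ t ∈ X, t ∈ T ∧ ∃ p ∈ P, N.F t p ∧ N.Leads P T u n (N.post p)

/-- An allocation pointing to a transition `u`. If only allocated transitions are used, then in a
bounded net every allocated transition fires at most boundedly more often than `u`. -/
theorem exists_allocation [DecidableEq α] {P T : Set α} {u : α} {B : ℕ}
    (hB : ∀ μ, N.Reach μ₀ μ → ∀ p ∈ N.places, μ p ≤ B) (hP : ∀ p ∈ P, p ∈ N.places)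
    (h : ∀ p ∈ P, ∃ n, N.Leads P T u n (N.post p)) :
    ∃ c : Set α → α,
      (∀ p ∈ P, N.F p (c (N.post p)) ∧
        (c (N.post p) = u ∨ c (N.post p) ∈ T ∧ ∃ q ∈ P, N.F (c (N.post p)) q)) ∧
      ∀ p ∈ P, ∃ C : ℕ, ∀ σ ν, N.FireSeq μ₀ σ ν →
        (∀ w ∈ σ, ∀ q ∈ P, N.F q w → w = c (N.post q)) →
        σ.count (c (N.post p)) ≤ C + σ.count u := by
  have hc : ∀ X : Set α, ∃ t, ∀ n, N.Leads P T u n X → (∀ m < n, ¬ N.Leads P T u m X) →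
      t ∈ X ∧ (t = u ∨ t ∈ T ∧ ∃ q ∈ P, N.F t q ∧ ∃ m < n, N.Leads P T u m (N.post q)) := by
    intro X
    by_cases hX : ∃ n, N.Leads P T u n X
    · have hspec := Nat.find_spec hX
      have hmin := fun m => Nat.find_min hX (m := m)
      generalize Nat.find hX = n at hspec hmin
      have huniq : ∀ k, N.Leads P T u k X → (∀ m < k, ¬ N.Leads P T u m X) → k = n :=
        fun k hk hk' => le_antisymm (not_lt.mp fun hlt => hk' n hlt hspec)
          (not_lt.mp fun hlt => hmin k hlt hk)
      cases n with
      | zero =>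
        refine ⟨u, fun k hk hk' => ⟨hspec, Or.inl rfl⟩⟩
      | succ n =>
        obtain ⟨t, htX, htT, p, hp, hF, hL⟩ := hspec
        refine ⟨t, fun k hk hk' => ⟨htX, Or.inr ⟨htT, p, hp, hF, n, ?_, hL⟩⟩⟩
        rw [huniq k hk hk']
        exact Nat.lt_succ_self n
    · exact ⟨u, fun n hn => absurd ⟨n, hn⟩ hX⟩
  choose c hc using hc
  refine ⟨c, fun p hp => ?_, ?_⟩
  · have := hc _ _ (Nat.find_spec (h p hp)) fun m => Nat.find_min (h p hp)
    refine ⟨this.1, this.2.imp_right ?_⟩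
    rintro ⟨hT, q, hq, hF, -⟩
    exact ⟨hT, q, hq, hF⟩
  · have key : ∀ n, ∀ p ∈ P, (∃ m ≤ n, N.Leads P T u m (N.post p)) → ∃ C : ℕ, ∀ σ ν,
        N.FireSeq μ₀ σ ν → (∀ w ∈ σ, ∀ q ∈ P, N.F q w → w = c (N.post q)) →
        σ.count (c (N.post p)) ≤ C + σ.count u := by
      intro n
      induction n using Nat.strong_induction_on with
      | _ n ih =>
        rintro p hp ⟨k, hk, hL⟩
        obtain ⟨-, hcu | ⟨-, q, hq, hF, m, hm, hL'⟩⟩ :=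
          hc _ _ (Nat.find_spec (h p hp)) fun m => Nat.find_min (h p hp)
        · exact ⟨0, fun σ ν _ _ => by simp [hcu]⟩
        · have hmn : m < n := hm.trans_le ((Nat.find_min' (h p hp) hL).trans hk)
          obtain ⟨C, hC⟩ := ih m hmn q hq ⟨m, le_rfl, hL'⟩
          refine ⟨C + B, fun σ ν hσ hA => ?_⟩
          have h1 := hσ.count_le hF (fun w hw => hA w hw q hq)
          have h2 := hC σ ν hσ hA
          have h3 := hB ν hσ.reach q (hP q hq)
          omega
    intro p hp
    obtain ⟨n, hn⟩ := h p hp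
    exact key n p hp ⟨n, le_rfl, hn⟩

/-! ### Minimal siphons -/

theorem Enabled.sum_fire {t : α} (h : N.Enabled μ t) (Q : Finset α) :
    ∑ q ∈ Q, N.fire t μ q + (Q.filter (fun q => N.F q t)).card =
      ∑ q ∈ Q, μ q + (Q.filter (fun q => N.F t q)).card := by
  rw [Finset.card_filter, Finset.card_filter, ← Finset.sum_add_distrib, ← Finset.sum_add_distrib]
  refine Finset.sum_congr rfl fun q _ => ?_
  have := h.2 q
  simp only [fire]
  split_ifs <;> grind

/-- A transition enabled after an occurrence sequence and satisfying `W` yields a prefix avoiding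
`W` after which some transition satisfying `W` is enabled. -/
theorem FireSeq.exists_avoiding {W : α → Prop} (h : N.FireSeq μ σ ν) {t : α}
    (he : N.Enabled ν t) (hW : W t) :
    ∃ τ ρ u, N.FireSeq μ τ ρ ∧ (∀ w ∈ τ, ¬ W w) ∧ N.Enabled ρ u ∧ W u := by
  induction h with
  | nil μ => exact ⟨[], μ, t, .nil _, by simp, he, hW⟩
  | @cons μ ν w σ hw _ ih =>
    by_cases hWw : W w
    · exact ⟨[], μ, w, .nil _, by simp, hw, hWw⟩
    · obtain ⟨τ, ρ, u, hτ, hτW, hu, hWu⟩ := ih he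
      exact ⟨w :: τ, ρ, u, .cons hw hτ, by simpa using ⟨hWw, hτW⟩, hu, hWu⟩

/-- In a live and bounded free-choice net, no transition has two output places in a minimal siphon
which contains at most one input place of every transition. -/
theorem subsingleton_post_inter_siphon (hfc : N.FreeChoice) (hl : N.Live μ₀)
    (hb : N.Bounded μ₀) {Q : Finset α} (hQ : N.IsSiphon (Q : Set α))
    (hmin : ∀ R ⊆ Q, R.Nonempty → N.IsSiphon (R : Set α) → R = Q)
    (hone : ∀ t, ∀ q ∈ Q, ∀ q' ∈ Q, N.F q t → N.F q' t → q = q') {u q₁ q₂ : α}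
    (hq₁ : q₁ ∈ Q) (hq₂ : q₂ ∈ Q) (h₁ : N.F u q₁) (h₂ : N.F u q₂) : q₁ = q₂ := by
  by_contra hne
  obtain ⟨B, hB⟩ := hb
  have hQP : ∀ q ∈ Q, q ∈ N.places := fun q hq => hQ.1 q hq
  obtain ⟨q₀, hq₀, h₀⟩ := hQ.2 q₁ hq₁ u h₁
  have hG : Q.filter (fun q => ∃ n, N.Leads Q Set.univ u n (N.post q)) = Q := by
    refine hmin _ (Finset.filter_subset _ _) ⟨q₀, by simpa using ⟨hq₀, 0, h₀⟩⟩
      ⟨fun q hq => hQP q (Finset.mem_of_mem_filter q (Finset.mem_coe.mp hq)), fun q hq t hF => ?_⟩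
    obtain ⟨hq, n, hn⟩ := Finset.mem_filter.mp (Finset.mem_coe.mp hq)
    obtain ⟨q', hq', hF'⟩ := hQ.2 q hq t hF
    exact ⟨q', by simpa using ⟨hq', n + 1, t, hF', trivial, q, hq, hF, hn⟩, hF'⟩
  obtain ⟨c, hc, hbound⟩ := exists_allocation (P := (Q : Set α)) (T := Set.univ) (u := u) hB hQP
    (fun q hq => by
      have : q ∈ Q.filter (fun q => ∃ n, N.Leads Q Set.univ u n (N.post q)) := hG.symm ▸ hq
      exact (Finset.mem_filter.mp this).2)
  set A : α → Prop := fun w => ∀ q ∈ (Q : Set α), N.F q w → w = c (N.post q)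
  have hin : ∀ w, (Q.filter (fun q => N.F q w)).card ≤ 1 := fun w =>
    Finset.card_le_one.mpr fun a ha b hb => by
      rw [Finset.mem_filter] at ha hb
      exact hone w a ha.1 b hb.1 ha.2 hb.2
  have hu2 : 2 ≤ (Q.filter (fun q => N.F u q)).card :=
    Finset.one_lt_card.mpr ⟨q₁, by simp [hq₁, h₁], q₂, by simp [hq₂, h₂], hne⟩
  have hgrow : ∀ w, A w → (Q.filter (fun q => N.F q w)).card + (if w = u then 1 else 0) ≤
      (Q.filter (fun q => N.F w q)).card := by
    intro w hw
    have := hin w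
    split_ifs with hwu
    · subst hwu
      omega
    · by_cases hex : ∃ q ∈ Q, N.F q w
      · obtain ⟨q, hq, hF⟩ := hex
        obtain rfl := hw q hq hF
        obtain ⟨-, h | ⟨-, q', hq', hF'⟩⟩ := hc q hq
        · exact absurd h hwu
        · have : 0 < (Q.filter (fun x => N.F (c (N.post q)) x)).card :=
            Finset.card_pos.mpr ⟨q', by simpa using ⟨hq', hF'⟩⟩
          omega
      · have : Q.filter (fun q => N.F q w) = ∅ := by
          rw [Finset.filter_eq_empty_iff]
          exact fun q hq hF => hex ⟨q, hq, hF⟩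
        simp [this]
  have hcount : ∀ {μ σ ν}, N.FireSeq μ σ ν → (∀ w ∈ σ, A w) →
      ∑ q ∈ Q, μ q + σ.count u ≤ ∑ q ∈ Q, ν q := by
    intro μ σ ν h
    induction h with
    | nil => simp
    | @cons μ ν w σ hw _ ih =>
      intro hAσ
      have h1 := ih fun x hx => hAσ x (List.mem_cons_of_mem _ hx)
      have h2 := hw.sum_fire Q
      have h3 := hgrow w (hAσ w List.mem_cons_self)
      rw [List.count_cons]
      simp only [beq_iff_eq]
      omega
  obtain ⟨μ, hμ, hstuck⟩ := exists_reach_stuck (N := N) (μ₀ := μ₀) A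
      (fun w => ∃ q ∈ Q, N.F q w) <| by
    rintro t - ⟨q, hq, hF⟩
    obtain ⟨C, hC⟩ := hbound q hq
    refine ⟨C + ∑ _q ∈ Q, B, fun σ ν hσ hAσ => ?_⟩
    by_cases ht : t ∈ σ
    · obtain rfl := hAσ t ht q hq hF
      have h1 := hC σ ν hσ hAσ
      have h2 := hcount hσ hAσ
      have h3 : ∑ q ∈ Q, ν q ≤ ∑ _q ∈ Q, B :=
        Finset.sum_le_sum fun q hq => hB ν hσ.reach q (hQP q hq)
      omega
    · rw [List.count_eq_zero_of_not_mem ht]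
      exact Nat.zero_le _
  obtain ⟨ν, ⟨σ, hσ⟩, he⟩ := hl u (transition_of_place_F h₀ (hQP _ hq₀)) μ hμ
  obtain ⟨τ, ρ, t, hτ, hτW, ht, q, hq, hF⟩ :=
    hσ.exists_avoiding (W := fun w => ∃ q ∈ Q, N.F q w) he ⟨q₀, hq₀, h₀⟩
  have hFc := (hc q hq).1
  have hec := hfc.enabled (hQP q hq) hF hFc ht
  refine hstuck _ _ (hτ.append hec.fireSeq) ?_ (c (N.post q)) (by simp) ⟨q, hq, hFc⟩
  intro w hw q' hq' hF'
  rcases List.mem_append.mp hw with hw | hw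
  · exact absurd ⟨q', hq', hF'⟩ (hτW w hw)
  · obtain rfl := List.mem_singleton.mp hw
    rw [hone _ q hq q' hq' hFc hF']

theorem FireSeq.sum_le {Q : Finset α} (h : N.FireSeq μ σ ν)
    (hQ : ∀ t, (Q.filter (fun q => N.F t q)).card ≤ (Q.filter (fun q => N.F q t)).card) :
    ∑ q ∈ Q, ν q ≤ ∑ q ∈ Q, μ q := by
  induction h with
  | nil => exact le_rfl
  | @cons μ ν w σ hw _ ih =>
    have h1 := hw.sum_fire Q
    have h2 := hQ w
    omega

theorem FireSeq.sum_eq {Q : Finset α} (h : N.FireSeq μ σ ν)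
    (hQ : ∀ t ∈ N.transitions,
      (Q.filter (fun q => N.F t q)).card = (Q.filter (fun q => N.F q t)).card) :
    ∑ q ∈ Q, ν q = ∑ q ∈ Q, μ q := by
  induction h with
  | nil => rfl
  | @cons μ ν w σ hw _ ih =>
    have h1 := hw.sum_fire Q
    have h2 := hQ w hw.1
    omega

/-- In a perpetual free-choice system, a minimal siphon which contains at most one input place of
every transition carries at most one token. -/
theorem Perpetual.sum_siphon_le_one [DecidableEq α] {cl : Set α} (hperp : N.Perpetual μ₀ cl)
    (hfc : N.FreeChoice) {Q : Finset α} (hQ : N.IsSiphon (Q : Set α))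
    (hmin : ∀ R ⊆ Q, R.Nonempty → N.IsSiphon (R : Set α) → R = Q)
    (hone : ∀ t, ∀ q ∈ Q, ∀ q' ∈ Q, N.F q t → N.F q' t → q = q')
    (hpost : ∀ q ∈ Q, ∃ t, N.F q t) (h : N.Reach μ₀ μ) : ∑ q ∈ Q, μ q ≤ 1 := by
  obtain ⟨hl, hb, hcl, hhome⟩ := hperp
  have hQP : ∀ q ∈ Q, q ∈ N.places := fun q hq => hQ.1 q hq
  have hle : ∀ t, (Q.filter (fun q => N.F t q)).card ≤ (Q.filter (fun q => N.F q t)).card := by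
    intro t
    by_cases hex : ∃ q ∈ Q, N.F t q
    · obtain ⟨q, hq, hF⟩ := hex
      obtain ⟨q', hq', hF'⟩ := hQ.2 q hq t hF
      calc _ ≤ 1 := Finset.card_le_one.mpr fun a ha b hb' => by
            rw [Finset.mem_filter] at ha hb'
            exact subsingleton_post_inter_siphon hfc hl hb hQ hmin hone ha.1 hb'.1 ha.2 hb'.2
        _ ≤ _ := Finset.card_pos.mpr ⟨q', by simpa using ⟨hq', hF'⟩⟩
    · rw [Finset.filter_eq_empty_iff.mpr fun q hq hF => hex ⟨q, hq, hF⟩]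
      simp
  have hsum : ∀ {ν}, N.MarkingEq ν (N.clusterMarking cl) →
      ∑ q ∈ Q, ν q = ∑ q ∈ Q, N.clusterMarking cl q :=
    fun hν => Finset.sum_congr rfl fun q hq => hν q (hQP q hq)
  have heq : ∀ t ∈ N.transitions,
      (Q.filter (fun q => N.F t q)).card = (Q.filter (fun q => N.F q t)).card := by
    intro t ht
    refine le_antisymm (hle t) (not_lt.mp fun hlt => ?_)
    obtain ⟨ν₁, hν₁, hm₁⟩ := hhome μ h
    obtain ⟨ν₂, ⟨σ, hσ⟩, he⟩ := hl t ht ν₁ (h.trans hν₁)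
    obtain ⟨ν₃, ⟨τ, hτ⟩, hm₃⟩ :=
      hhome _ (((h.trans hν₁).trans hσ.reach).trans he.fireSeq.reach)
    have h1 := hσ.sum_le hle
    have h2 := he.sum_fire Q
    have h3 := hτ.sum_le hle
    rw [hsum hm₁] at h1
    rw [hsum hm₃] at h3
    omega
  obtain ⟨ν, ⟨σ, hσ⟩, hm⟩ := hhome μ h
  rw [← hσ.sum_eq heq, hsum hm]
  simp only [clusterMarking, Finset.sum_boole, Nat.cast_id]
  refine Finset.card_le_one.mpr fun a ha b hb' => ?_
  rw [Finset.mem_filter] at ha hb'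
  obtain ⟨t, ht⟩ := hpost a ha.1
  exact hone t a ha.1 b hb'.1 ht (hcl.F_of_F hfc ha.2.1 hb'.2.1 ha.2.2 hb'.2.2 ht)

/-- In a perpetual free-choice system, let `p` be an input place of a transition `t` such that
some reachable marking enables no transition but `t`. Then `p` lies in a siphon carrying at most
one token. -/
theorem Perpetual.exists_siphon [DecidableEq α] {cl : Set α} (hperp : N.Perpetual μ₀ cl)
    (hfc : N.FreeChoice) {p t : α} (hp : p ∈ N.places) (hF : N.F p t) (h : N.Reach μ₀ μ)
    (ht : ∀ u, N.Enabled μ u → u = t) :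
    ∃ Q : Finset α, p ∈ Q ∧ N.IsSiphon (Q : Set α) ∧
      ∀ ν, N.Reach μ₀ ν → ∑ q ∈ Q, ν q ≤ 1 := by
  have hs : ∀ X : Set α, ∃ q, (p ∈ X → q = p) ∧ (p ∉ X → (∃ a ∈ X, μ a = 0) → q ∈ X ∧ μ q = 0) := by
    intro X
    by_cases hX : p ∈ X
    · exact ⟨p, by simp [hX]⟩
    · by_cases hex : ∃ a ∈ X, μ a = 0
      · obtain ⟨a, ha⟩ := hex
        exact ⟨a, by simp [hX, ha]⟩
      · exact ⟨p, by simp [hX, hex]⟩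
  choose s hs₁ hs₂ using hs
  have hsmem : ∀ u ∈ N.transitions, N.F (s (N.pre u)) u ∧
      (s (N.pre u) = p ∨ μ (s (N.pre u)) = 0) := by
    intro u hu
    by_cases hpu : p ∈ N.pre u
    · rw [hs₁ _ hpu]
      exact ⟨hpu, Or.inl rfl⟩
    · have hne : u ≠ t := fun h => hpu (h ▸ hF)
      have hdis : ¬ N.Enabled μ u := fun he => hne (ht u he)
      have hex : ∃ a ∈ N.pre u, μ a = 0 := by
        by_contra! hcon
        exact hdis ⟨hu, fun a ha => Nat.one_le_iff_ne_zero.mpr (hcon a ha)⟩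
      have := hs₂ _ hpu hex
      exact ⟨this.1, Or.inr this.2⟩
  set R : Finset α := N.transitions.image (fun u => s (N.pre u))
  have hRF : ∀ q ∈ R, ∃ u ∈ N.transitions, N.F q u ∧ q = s (N.pre u) := by
    intro q hq
    obtain ⟨u, hu, rfl⟩ := Finset.mem_image.mp hq
    exact ⟨u, hu, (hsmem u hu).1, rfl⟩
  have hRP : ∀ q ∈ R, q ∈ N.places := by
    intro q hq
    obtain ⟨u, hu, hqu, -⟩ := hRF q hq
    exact place_of_F_transition hqu hu
  have hRone : ∀ q ∈ R, ∀ u, N.F q u → q = s (N.pre u) := by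
    intro q hq u hqu
    obtain ⟨w, hw, hqw, hqs⟩ := hRF q hq
    rwa [hfc.pre_eq (hRP q hq) hqu hqw]
  have hRs : N.IsSiphon (R : Set α) := by
    refine ⟨hRP, fun q hq u hu => ?_⟩
    have huT := transition_of_F_place hu (hRP q hq)
    exact ⟨s (N.pre u), Finset.mem_coe.mpr (Finset.mem_image_of_mem _ huT), (hsmem u huT).1⟩
  have htT := transition_of_place_F hF hp
  obtain ⟨Q, hQ⟩ := exists_minimal_of_wellFoundedLT
    (fun X : Finset α => X ⊆ R ∧ X.Nonempty ∧ N.IsSiphon (X : Set α))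
    ⟨R, subset_rfl, ⟨_, Finset.mem_image_of_mem _ htT⟩, hRs⟩
  obtain ⟨⟨hQR, ⟨q₀, hq₀⟩, hQs⟩, hQmin⟩ := hQ
  have hpost : ∀ q ∈ Q, ∃ t, N.F q t := fun q hq => by
    obtain ⟨u, -, hu, -⟩ := hRF q (hQR hq)
    exact ⟨u, hu⟩
  refine ⟨Q, ?_, hQs, fun ν hν => hperp.sum_siphon_le_one hfc hQs ?_ ?_ hpost hν⟩
  · obtain ⟨u, hu⟩ := hpost q₀ hq₀
    obtain ⟨q, hq, hpos⟩ := hQs.exists_marked hperp.1 h hq₀ hu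
    obtain ⟨w, hw, -, hqw⟩ := hRF q (hQR hq)
    rcases (hsmem w hw).2 with hqp | h0
    · rw [← hqp, ← hqw]
      exact hq
    · rw [← hqw] at h0
      omega
  · exact fun X hX hne hXs => hX.antisymm (hQmin ⟨hX.trans hQR, hne, hXs⟩ hX)
  · intro u q hq q' hq' h1 h2
    rw [hRone q (hQR hq) u h1, hRone q' (hQR hq') u h2]

/-! ### CP-subnets -/

section CPSubnet

variable [DecidableEq α] {S : Finset α}

/-- An input place outside a CP-subnet of one of its transitions has an output transition outside
the subnet. -/
theorem IsCPSubnet.exists_post_notMem (hS : N.IsCPSubnet S) {p : α} (hp : p ∈ N.places)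
    (hpS : p ∉ S) : ∃ u, u ∉ S ∧ N.F p u := by
  obtain ⟨-, -, -, -, -, ⟨w, hw⟩, hsc⟩ := hS
  obtain ⟨hw, hwT⟩ := Finset.mem_inter.mp hw
  have hpm : p ∈ N.nodes \ S := by simp [nodes, hp, hpS]
  rcases (hsc p hpm w hw).cases_head with h | ⟨u, ⟨-, hu, hF⟩, -⟩
  · exact absurd h (place_transition_ne hp hwT)
  · exact ⟨u, (Finset.mem_sdiff.mp hu).2, hF⟩

theorem IsWayIn.pre_notMem {t : α} (h : N.IsWayIn S t) (hS : N.IsCPSubnet S)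
    (hfc : N.FreeChoice) {q : α} (hq : N.F q t) : q ∉ S := by
  intro hqS
  obtain ⟨-, htT, p, hp, hpS, hF⟩ := h
  obtain ⟨u, huS, hu⟩ := hS.exists_post_notMem hp hpS
  exact huS (hS.2.2.2.1 q hqS (place_of_F_transition hq htT) u
    (Or.inr (hfc p hp t hF q hq u hu)))

theorem IsCPSubnet.mem_of_F (hS : N.IsCPSubnet S) {p t : α} (hp : p ∈ S) (hpP : p ∈ N.places)
    (h : N.F p t) : t ∈ S :=
  hS.2.2.2.1 p hp hpP t (Or.inr h)

theorem IsCPSubnet.mem_of_F' (hS : N.IsCPSubnet S) {p t : α} (hp : p ∈ S) (hpP : p ∈ N.places)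
    (h : N.F t p) : t ∈ S :=
  hS.2.2.2.1 p hp hpP t (Or.inl h)

theorem IsCPSubnet.pre_unique (hS : N.IsCPSubnet S) {p t u : α} (hp : p ∈ S) (hpP : p ∈ N.places)
    (ht : N.F t p) (hu : N.F u p) : t = u :=
  (hS.2.2.2.2.1 p hp hpP).1.unique ⟨hS.mem_of_F' hp hpP ht, ht⟩ ⟨hS.mem_of_F' hp hpP hu, hu⟩

theorem IsCPSubnet.post_unique (hS : N.IsCPSubnet S) {p t u : α} (hp : p ∈ S) (hpP : p ∈ N.places)
    (ht : N.F p t) (hu : N.F p u) : t = u :=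
  (hS.2.2.2.2.1 p hp hpP).2.unique ⟨hS.mem_of_F hp hpP ht, ht⟩ ⟨hS.mem_of_F hp hpP hu, hu⟩

theorem IsCPSubnet.exists_pre (hS : N.IsCPSubnet S) {p : α} (hp : p ∈ S) (hpP : p ∈ N.places) :
    ∃ t, N.F t p := by
  obtain ⟨t, ht, -⟩ := (hS.2.2.2.2.1 p hp hpP).1
  exact ⟨t, ht.2⟩

theorem IsCPSubnet.exists_post (hS : N.IsCPSubnet S) {p : α} (hp : p ∈ S) (hpP : p ∈ N.places) :
    ∃ t, N.F p t := by
  obtain ⟨t, ht, -⟩ := (hS.2.2.2.2.1 p hp hpP).2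
  exact ⟨t, ht.2⟩

/-- The state equation at a place of a CP-subnet. -/
theorem IsCPSubnet.state_equation (hS : N.IsCPSubnet S) (h : N.FireSeq μ σ ν) {p t u : α}
    (hp : p ∈ S) (hpP : p ∈ N.places) (ht : N.F t p) (hu : N.F p u) :
    ν p + σ.count u = μ p + σ.count t := by
  have h1 : σ.countP (fun w => N.F w p) = σ.count t :=
    List.countP_congr fun w _ => by
      simpa using ⟨fun hw => hS.pre_unique hp hpP hw ht, fun hw => hw ▸ ht⟩
  have h2 : σ.countP (fun w => N.F p w) = σ.count u :=
    List.countP_congr fun w _ => by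
      simpa using ⟨fun hw => hS.post_unique hp hpP hw hu, fun hw => hw ▸ hu⟩
  have := h.state_equation p
  rwa [h1, h2] at this

/-- In a bounded net, two transitions of a CP-subnet fire equally often up to a constant. -/
theorem IsCPSubnet.count_le (hS : N.IsCPSubnet S) {B : ℕ}
    (hB : ∀ μ, N.Reach μ₀ μ → ∀ p ∈ N.places, μ p ≤ B) {t u : α} (ht : t ∈ S)
    (htT : t ∈ N.transitions) (hu : u ∈ S) (huT : u ∈ N.transitions) :
    ∃ C : ℕ, ∀ σ ν, N.FireSeq μ₀ σ ν → σ.count t ≤ C + σ.count u := by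
  have hB₀ := hB μ₀ ⟨[], .nil _⟩
  have hadj : ∀ p ∈ S, p ∈ N.places → ∀ v w, N.F v p ∨ N.F p v → N.F w p ∨ N.F p w → ∀ σ ν,
      N.FireSeq μ₀ σ ν → σ.count v ≤ B + σ.count w := by
    intro p hp hpP v w hv hw σ ν hσ
    obtain ⟨a, ha⟩ := hS.exists_pre hp hpP
    obtain ⟨b, hb⟩ := hS.exists_post hp hpP
    have h1 := hS.state_equation hσ hp hpP ha hb
    have h2 := hB₀ p hpP
    have h3 := hB ν hσ.reach p hpP
    have hab : ∀ x, N.F x p ∨ N.F p x → x = a ∨ x = b := fun x hx =>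
      hx.imp (fun h => hS.pre_unique hp hpP h ha) (fun h => hS.post_unique hp hpP h hb)
    rcases hab v hv with rfl | rfl <;> rcases hab w hw with rfl | rfl <;> omega
  have key : ∀ n, Relation.ReflTransGen (fun a b => a ∈ S ∧ b ∈ S ∧ (N.F a b ∨ N.F b a)) t n →
      ∃ C : ℕ, ∀ w, (w = n ∧ n ∈ N.transitions ∨ n ∈ N.places ∧ (N.F w n ∨ N.F n w)) →
        ∀ σ ν, N.FireSeq μ₀ σ ν → σ.count t ≤ C + σ.count w := by
    intro n hn
    induction hn with
    | refl =>
      refine ⟨0, ?_⟩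
      rintro w (⟨rfl, -⟩ | ⟨h, -⟩) σ ν -
      · simp
      · exact absurd rfl (place_transition_ne h htT)
    | @tail a b _ hab ih =>
      obtain ⟨C, hC⟩ := ih
      obtain ⟨haS, hbS, hab⟩ := hab
      by_cases haT : a ∈ N.transitions
      · have hbP : b ∈ N.places := hab.elim (fun h => place_of_transition_F h haT)
          (fun h => place_of_F_transition h haT)
        refine ⟨C + B, ?_⟩
        rintro w (⟨-, h⟩ | ⟨-, hw⟩) σ ν hσ
        · exact absurd rfl (place_transition_ne hbP h)
        · have h1 := hC a (Or.inl ⟨rfl, haT⟩) σ ν hσ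
          have h2 := hadj b hbS hbP a w hab hw σ ν hσ
          omega
      · have haP : a ∈ N.places := by
          have := hS.2.1 haS
          simpa [nodes, haT] using this
        have hbT : b ∈ N.transitions := hab.elim (fun h => transition_of_place_F h haP)
          (fun h => transition_of_F_place h haP)
        refine ⟨C, ?_⟩
        rintro w (⟨rfl, -⟩ | ⟨h, -⟩) σ ν hσ
        · exact hC w (Or.inr ⟨haP, hab.symm⟩) σ ν hσ
        · exact absurd rfl (place_transition_ne h hbT)
  obtain ⟨C, hC⟩ := key u (hS.2.2.1 t ht u hu)
  exact ⟨C, hC u (Or.inl ⟨rfl, huT⟩)⟩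

/-- For each transition of a CP-subnet other than a given way-in transition, some reachable marking
of a live and bounded free-choice system enables this transition only, and this transition is not
a way-in transition. -/
theorem IsCPSubnet.exists_reach_enabled_only (hS : N.IsCPSubnet S) (hfc : N.FreeChoice)
    (hl : N.Live μ₀) (hb : N.Bounded μ₀) {tin t : α} (htin : N.IsWayIn S tin) (ht : t ∈ S)
    (htT : t ∈ N.transitions) (hne : t ≠ tin) :
    ¬ N.IsWayIn S t ∧ ∃ μ, N.Reach μ₀ μ ∧ ∀ u, N.Enabled μ u → u = t := by
  obtain ⟨B, hB⟩ := hb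
  obtain ⟨htinS, htinT, p₀, hp₀, hp₀S, hF₀⟩ := htin
  have hp₀m : p₀ ∈ N.nodes \ S := by simp [nodes, hp₀, hp₀S]
  set P : Set α := {p | p ∈ N.places ∧ p ∉ S}
  set T : Set α := {u | u ∉ S}
  have hleads : ∀ p ∈ P, ∃ n, N.Leads P T tin n (N.post p) := by
    have key : ∀ a, Relation.ReflTransGen
        (fun a b => a ∈ N.nodes \ S ∧ b ∈ N.nodes \ S ∧ N.F a b) a p₀ →
        (a ∈ N.places → ∃ n, N.Leads P T tin n (N.post a)) ∧
        (a ∈ N.transitions → ∃ p ∈ P, N.F a p ∧ ∃ n, N.Leads P T tin n (N.post p)) := by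
      intro a ha
      induction ha using Relation.ReflTransGen.head_induction_on with
      | refl =>
        exact ⟨fun _ => ⟨0, hF₀⟩, fun h => absurd rfl (place_transition_ne hp₀ h)⟩
      | @head a b hab _ ih =>
        obtain ⟨-, hb, hF⟩ := hab
        have hbS := (Finset.mem_sdiff.mp hb).2
        refine ⟨fun haP => ?_, fun haT => ?_⟩
        · obtain ⟨p, hp, hbp, n, hn⟩ := ih.2 (transition_of_place_F hF haP)
          exact ⟨n + 1, b, hF, hbS, p, hp, hbp, hn⟩
        · have hbP := place_of_transition_F hF haT
          exact ⟨b, ⟨hbP, hbS⟩, hF, ih.1 hbP⟩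
    intro p hp
    exact (key p (hS.2.2.2.2.2.2 p (by simp [nodes, hp.1, hp.2]) p₀ hp₀m)).1 hp.1
  obtain ⟨c, hc, hbound⟩ := exists_allocation hB (fun p (hp : p ∈ P) => hp.1) hleads
  set A : α → Prop := fun w =>
    w ∈ S ∧ ¬ N.IsWayIn S w ∧ w ≠ t ∨ ∃ p ∈ P, N.F p w ∧ w = c (N.post p)
  have htA : ¬ A t := by
    rintro (⟨-, -, h⟩ | ⟨p, hp, -, h⟩)
    · exact h rfl
    · rcases (hc p hp).2 with h' | ⟨h', -⟩
      · exact hne (h.trans h')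
      · exact h' (h ▸ ht)
  have halloc : ∀ w, A w → ∀ q ∈ P, N.F q w → w = c (N.post q) := by
    rintro w (⟨hwS, hw, -⟩ | ⟨p, hp, hpw, hw⟩) q hq hqw
    · exact absurd ⟨hwS, transition_of_place_F hqw hq.1, q, hq.1, hq.2, hqw⟩ hw
    · rw [hw, hfc.post_eq hp.1 hpw hqw]
  have hcS : ∀ u ∈ S, u ∈ N.transitions → ∃ C : ℕ, ∀ σ ν, N.FireSeq μ₀ σ ν → (∀ w ∈ σ, A w) →
      σ.count u ≤ C := by
    intro u hu huT
    obtain ⟨C, hC⟩ := hS.count_le hB hu huT ht htT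
    refine ⟨C, fun σ ν hσ hAσ => ?_⟩
    have := hC σ ν hσ
    rwa [List.count_eq_zero_of_not_mem fun h => htA (hAσ t h)] at this
  obtain ⟨μ, hμ, hstuck⟩ := exists_reach_stuck (N := N) (μ₀ := μ₀) A (fun _ => True) <| by
    rintro u huT -
    by_cases huS : u ∈ S
    · exact hcS u huS huT
    by_cases huA : A u
    · obtain ⟨h, -⟩ | ⟨p, hp, -, rfl⟩ := huA
      · exact absurd h huS
      · obtain ⟨C, hC⟩ := hbound p hp
        obtain ⟨C', hC'⟩ := hcS tin htinS htinT
        refine ⟨C + C', fun σ ν hσ hAσ => ?_⟩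
        have h1 := hC σ ν hσ fun w hw => halloc w (hAσ w hw)
        have h2 := hC' σ ν hσ hAσ
        omega
    · refine ⟨0, fun σ ν _ hAσ => ?_⟩
      rw [List.count_eq_zero_of_not_mem fun h => huA (hAσ u h)]
  have hdead : ∀ u, A u → ¬ N.Enabled μ u := fun u hu he =>
    hstuck [u] _ he.fireSeq (by simpa using hu) u (by simp) trivial
  have hPdead : ∀ u, N.Enabled μ u → ∀ p ∈ P, ¬ N.F p u := fun u hu p hp hF =>
    hdead _ (Or.inr ⟨p, hp, (hc p hp).1, rfl⟩) (hfc.enabled hp.1 hF (hc p hp).1 hu)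
  have honly : ∀ u, N.Enabled μ u → u = t ∧ ¬ N.IsWayIn S u := by
    intro u hu
    have huW : ¬ N.IsWayIn S u := by
      rintro ⟨-, -, p, hp, hpS, hF⟩
      exact hPdead u hu p ⟨hp, hpS⟩ hF
    refine ⟨?_, huW⟩
    by_contra hut
    by_cases huS : u ∈ S
    · exact hdead u (Or.inl ⟨huS, huW, hut⟩) hu
    · have hum : u ∈ N.nodes \ S := by simp [nodes, hu.1, huS]
      rcases (hS.2.2.2.2.2.2 p₀ hp₀m u hum).cases_tail with h | ⟨p, -, hp, -, hF⟩
      · exact place_transition_ne hp₀ hu.1 h.symm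
      · exact hPdead u hu p ⟨place_of_F_transition hF hu.1, (Finset.mem_sdiff.mp hp).2⟩ hF
  obtain ⟨u, hu⟩ := hl.exists_enabled ⟨tin, htinT⟩ hμ
  obtain ⟨rfl, hW⟩ := honly u hu
  exact ⟨hW, μ, hμ, fun w hw => (honly w hw).1⟩

/-- In a live and bounded free-choice system, each transition of a CP-subnet other than a given
way-in transition has an input place in the subnet, and all of its input places are there. -/
theorem IsCPSubnet.pre_mem (hS : N.IsCPSubnet S) (hfc : N.FreeChoice)
    (hl : N.Live μ₀) (hb : N.Bounded μ₀) {tin t : α} (htin : N.IsWayIn S tin) (ht : t ∈ S)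
    (htT : t ∈ N.transitions) (hne : t ≠ tin) :
    (∀ p, N.F p t → p ∈ S) ∧ ∃ p ∈ S, p ∈ N.places ∧ N.F p t := by
  have hmem : ∀ p, N.F p t → p ∈ S := by
    intro p hp
    by_contra hpS
    exact (hS.exists_reach_enabled_only hfc hl hb htin ht htT hne).1
      ⟨ht, htT, p, place_of_F_transition hp htT, hpS, hp⟩
  refine ⟨hmem, ?_⟩
  by_contra! hcon
  have hsource : ∀ p, ¬ N.F p t := fun p hp =>
    hcon p (hmem p hp) (place_of_F_transition hp htT) hp
  rcases (hS.2.2.1 t ht tin htin.1).cases_head with h | ⟨p, ⟨-, -, hp⟩, -⟩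
  · exact hne h
  · replace hp := hp.resolve_right (hsource p)
    have hpP := place_of_transition_F hp htT
    obtain ⟨B, hB⟩ := hb
    obtain ⟨μ, -, hstuck⟩ := exists_reach_stuck (N := N) (μ₀ := μ₀) (· = t) (fun _ => True) <| by
      rintro u huT -
      refine ⟨B, fun σ ν hσ hA => ?_⟩
      by_cases hu : u ∈ σ
      · obtain rfl := hA u hu
        have h1 := hσ.state_equation p
        have h2 := hB ν hσ.reach p hpP
        have h3 : σ.count u ≤ σ.countP (fun w => N.F w p) :=
          List.countP_mono_left (by grind)
        have h4 : σ.countP (fun w => N.F p w) = 0 :=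
          List.countP_eq_zero.mpr fun w hw => by
            rw [hA w hw]
            simpa using hsource p
        omega
      · rw [List.count_eq_zero_of_not_mem hu]
        exact Nat.zero_le _
    exact hstuck [t] _ (Enabled.fireSeq ⟨htT, fun q hq => absurd hq (hsource q)⟩) (by simp) t
      (by simp) trivial

/-- The marking of the regeneration cluster does not mark an adapted CP-subnet. -/
theorem IsCPSubnet.clusterMarking_eq_zero (hS : N.IsCPSubnet S) (hfc : N.FreeChoice)
    {cl : Set α} (hcl : N.IsCluster cl) (had : ¬ cl ⊆ (S : Set α)) {p : α} (hp : p ∈ S) :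
    N.clusterMarking cl p = 0 := by
  have key := hcl.subset_or_subset_compl (V := {x | x ∈ S ∧ ¬ N.IsWayIn S x})
    ⟨fun x hx hxP u hu => ⟨hS.mem_of_F hx.1 hxP hu, fun h => h.pre_notMem hS hfc hu hx.1⟩,
      fun x hx hxT u hu => ?_⟩
    ⟨fun x hx hxP u hu hmem => ?_, fun x hx hxT u hu hmem => ?_⟩
  · rcases key with h | h
    · exact absurd (fun x hx => (h hx).1) had
    · rw [clusterMarking, if_neg]
      rintro ⟨hpc, hpP⟩
      exact h hpc ⟨hp, fun hW => place_transition_ne hpP hW.2.1 rfl⟩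
  · have huP := place_of_F_transition hu hxT
    refine ⟨by_contra fun huS => hx.2 ⟨hx.1, hxT, u, huP, huS, hu⟩, fun hW => ?_⟩
    exact place_transition_ne huP hW.2.1 rfl
  · refine hmem.2 ⟨hmem.1, transition_of_place_F hu hxP, x, hxP,
      fun hxS => hx ⟨hxS, fun hW => ?_⟩, hu⟩
    exact place_transition_ne hxP hW.2.1 rfl
  · have huP := place_of_F_transition hu hxT
    refine hx ⟨hS.mem_of_F hmem.1 huP hu, fun hW => hW.pre_notMem hS hfc hu hmem.1⟩

theorem Perpetual.exists_reach_eq_zero {cl : Set α} (hperp : N.Perpetual μ₀ cl)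
    (hfc : N.FreeChoice) (hS : N.IsCPSubnet S) (had : ¬ cl ⊆ (S : Set α)) (h : N.Reach μ₀ μ) :
    ∃ ν, N.Reach μ ν ∧ ∀ p ∈ S, p ∈ N.places → ν p = 0 := by
  obtain ⟨ν, hν, hm⟩ := hperp.2.2.2 μ h
  exact ⟨ν, hν, fun p hp hpP =>
    (hm p hpP).trans (hS.clusterMarking_eq_zero hfc hperp.2.2.1 had hp)⟩

/-- The transition `t` precedes the transition `u` via a place of `S`. -/
def Precedes (N : Net α) (S : Finset α) (t u : α) : Prop :=
  ∃ p ∈ S, p ∈ N.places ∧ N.F t p ∧ N.F p u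

/-- An adapted CP-subnet is acyclic. -/
theorem Perpetual.wellFounded_precedes {cl : Set α} (hperp : N.Perpetual μ₀ cl)
    (hfc : N.FreeChoice) (hS : N.IsCPSubnet S) (had : ¬ cl ⊆ (S : Set α)) :
    WellFounded (N.Precedes S) := by
  rw [WellFounded.wellFounded_iff_has_min]
  by_contra! hcon
  obtain ⟨C, ⟨t, ht⟩, hC⟩ := hcon
  have hsiphon : N.IsSiphon {p | p ∈ S ∧ p ∈ N.places ∧ ∃ t ∈ C, N.F t p} := by
    refine ⟨fun q hq => hq.2.1, ?_⟩
    rintro q ⟨hqS, hqP, u, hu, hF⟩ w hw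
    obtain rfl := hS.pre_unique hqS hqP hF hw
    obtain ⟨v, hv, p, hp, hpP, hvp, hpu⟩ := hC u hu
    exact ⟨p, ⟨hp, hpP, v, hv, hvp⟩, hpu⟩
  obtain ⟨ν, hν, h0⟩ := hperp.exists_reach_eq_zero hfc hS had ⟨[], .nil _⟩
  obtain ⟨v, hv, p, hp, hpP, hvp, hpt⟩ := hC t ht
  obtain ⟨q, hq, hpos⟩ := hsiphon.exists_marked hperp.1 hν (q := p) ⟨hp, hpP, v, hv, hvp⟩ hpt
  rw [h0 q hq.1 hq.2.1] at hpos
  exact lt_irrefl 0 hpos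

/-- `z` counts how often each transition of the subnet has to fire in order to empty the subnet
without using the way-in transition. -/
def IsEmptying (N : Net α) (S : Finset α) (tin : α) (μ z : α → ℕ) : Prop :=
  z tin = 0 ∧ ∀ p ∈ S, p ∈ N.places → ∀ t u, N.F t p → N.F p u → z u = μ p + z t

theorem Perpetual.exists_isEmptying {cl : Set α} (hperp : N.Perpetual μ₀ cl)
    (hfc : N.FreeChoice) (hS : N.IsCPSubnet S) (had : ¬ cl ⊆ (S : Set α)) {tin : α}
    (htin : N.IsWayIn S tin) (h : N.Reach μ₀ μ) : ∃ z, N.IsEmptying S tin μ z := by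
  obtain ⟨ν, ⟨σ, hσ⟩, h0⟩ := hperp.exists_reach_eq_zero hfc hS had h
  have hstate : ∀ p ∈ S, p ∈ N.places → ∀ t u, N.F t p → N.F p u →
      σ.count u = μ p + σ.count t := by
    intro p hp hpP t u ht hu
    have := hS.state_equation hσ hp hpP ht hu
    rwa [h0 p hp hpP, zero_add] at this
  have hge : ∀ t, t ∈ S → t ∈ N.transitions → σ.count tin ≤ σ.count t := by
    intro t
    induction t using (hperp.wellFounded_precedes hfc hS had).induction with
    | _ t ih =>
      intro ht htT
      by_cases hne : t = tin
      · rw [hne]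
      · obtain ⟨-, p, hp, hpP, hF⟩ := hS.pre_mem hfc hperp.1 hperp.2.1 htin ht htT hne
        obtain ⟨v, hv⟩ := hS.exists_pre hp hpP
        have h1 := ih v ⟨p, hp, hpP, hv, hF⟩ (hS.mem_of_F' hp hpP hv) (transition_of_F_place hv hpP)
        have h2 := hstate p hp hpP v t hv hF
        omega
  refine ⟨fun t => σ.count t - σ.count tin, by simp, fun p hp hpP t u ht hu => ?_⟩
  have h1 := hstate p hp hpP t u ht hu
  have h2 := hge t (hS.mem_of_F' hp hpP ht) (transition_of_F_place ht hpP)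
  simp only
  omega

theorem IsEmptying.le_one {cl : Set α} {z : α → ℕ} {tin t : α} (hz : N.IsEmptying S tin μ z)
    (hperp : N.Perpetual μ₀ cl) (hfc : N.FreeChoice) (hS : N.IsCPSubnet S)
    (had : ¬ cl ⊆ (S : Set α)) (htin : N.IsWayIn S tin) (h : N.Reach μ₀ μ) (ht : t ∈ S)
    (htT : t ∈ N.transitions) : z t ≤ 1 := by
  by_cases hne : t = tin
  · rw [hne, hz.1]
    exact Nat.zero_le 1
  have hwf := hperp.wellFounded_precedes hfc hS had
  obtain ⟨-, p₀, hp₀, hp₀P, hF₀⟩ := hS.pre_mem hfc hperp.1 hperp.2.1 htin ht htT hne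
  obtain ⟨-, ν, hν, honly⟩ := hS.exists_reach_enabled_only hfc hperp.1 hperp.2.1 htin ht htT hne
  obtain ⟨Q, hpQ, hQ, hQ1⟩ := hperp.exists_siphon hfc hp₀P hF₀ hν honly
  have : IsWellFounded α (N.Precedes S) := ⟨hwf⟩
  set rk := IsWellFounded.rank (N.Precedes S)
  have key : ∀ u, (∃ q ∈ Q, q ∈ S ∧ N.F q u) →
      z u ≤ ∑ q ∈ Q with ∃ w, N.F q w ∧ rk w ≤ rk u, μ q := by
    intro u
    induction u using hwf.induction with
    | _ u ih =>
      rintro ⟨q, hq, hqS, hF⟩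
      have hqP : q ∈ N.places := hQ.1 q hq
      obtain ⟨v, hv⟩ := hS.exists_pre hqS hqP
      have hvu : N.Precedes S v u := ⟨q, hqS, hqP, hv, hF⟩
      have hlt : rk v < rk u := IsWellFounded.rank_lt_of_rel hvu
      have hvT := transition_of_F_place hv hqP
      have hqmem : q ∈ Q.filter (fun q => ∃ w, N.F q w ∧ rk w ≤ rk u) :=
        Finset.mem_filter.mpr ⟨hq, u, hF, le_rfl⟩
      rw [hz.2 q hqS hqP v u hv hF]
      by_cases hvin : v = tin
      · rw [hvin, hz.1, add_zero]
        exact Finset.single_le_sum (f := μ) (fun _ _ => Nat.zero_le _) hqmem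
      · obtain ⟨q', hq', hF'⟩ := hQ.2 q hq v hv
        have hq'S := (hS.pre_mem hfc hperp.1 hperp.2.1 htin (hS.mem_of_F' hqS hqP hv) hvT hvin).1
          q' hF'
        have hih := ih v hvu ⟨q', hq', hq'S, hF'⟩
        have hnot : q ∉ Q.filter (fun q => ∃ w, N.F q w ∧ rk w ≤ rk v) := by
          intro hmem
          obtain ⟨-, w, hw, hle⟩ := Finset.mem_filter.mp hmem
          rw [hS.post_unique hqS hqP hw hF] at hle
          exact absurd hlt (not_lt.mpr hle)
        calc μ q + z v ≤ μ q + ∑ q ∈ Q with ∃ w, N.F q w ∧ rk w ≤ rk v, μ q := by omega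
          _ = ∑ q ∈ insert q (Q.filter (fun q => ∃ w, N.F q w ∧ rk w ≤ rk v)), μ q :=
            (Finset.sum_insert hnot).symm
          _ ≤ _ := Finset.sum_le_sum_of_subset (by
            intro x hx
            rcases Finset.mem_insert.mp hx with rfl | hx
            · exact hqmem
            · obtain ⟨hxQ, w, hw, hle⟩ := Finset.mem_filter.mp hx
              exact Finset.mem_filter.mpr ⟨hxQ, w, hw, hle.trans hlt.le⟩)
  exact ((key t ⟨p₀, hpQ, hp₀, hF₀⟩).trans
    (Finset.sum_le_sum_of_subset (Finset.filter_subset _ _))).trans (hQ1 μ h)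

/-- An adapted CP-subnet of a perpetual free-choice system is lucent. -/
theorem Perpetual.eq_on_of_enabled_iff {cl : Set α} (hperp : N.Perpetual μ₀ cl)
    (hfc : N.FreeChoice) (hS : N.IsCPSubnet S) (had : ¬ cl ⊆ (S : Set α)) {tin : α}
    (htin : N.IsWayIn S tin) {μ₁ μ₂ : α → ℕ} (h₁ : N.Reach μ₀ μ₁) (h₂ : N.Reach μ₀ μ₂)
    (hen : ∀ t ∈ S, t ≠ tin → (N.Enabled μ₁ t ↔ N.Enabled μ₂ t)) {p : α} (hp : p ∈ S)
    (hpP : p ∈ N.places) : μ₁ p = μ₂ p := by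
  obtain ⟨z₁, hz₁⟩ := hperp.exists_isEmptying hfc hS had htin h₁
  obtain ⟨z₂, hz₂⟩ := hperp.exists_isEmptying hfc hS had htin h₂
  have hwf := hperp.wellFounded_precedes hfc hS had
  have hle : ∀ {μ₁ μ₂ z₁ z₂}, N.Reach μ₀ μ₁ → N.IsEmptying S tin μ₁ z₁ →
      N.IsEmptying S tin μ₂ z₂ →
      (∀ t ∈ S, t ≠ tin → (N.Enabled μ₁ t ↔ N.Enabled μ₂ t)) →
      ∀ t, t ∈ S → t ∈ N.transitions → z₁ t ≤ z₂ t := by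
    intro μ₁ μ₂ z₁ z₂ h₁ hz₁ hz₂ hen t
    induction t using hwf.induction with
    | _ t ih =>
      intro ht htT
      by_cases hne : t = tin
      · rw [hne, hz₁.1]
        exact Nat.zero_le _
      obtain ⟨hpre, p, hp, hpP, hF⟩ := hS.pre_mem hfc hperp.1 hperp.2.1 htin ht htT hne
      have h1 : z₁ t ≤ 1 := hz₁.le_one hperp hfc hS had htin h₁ ht htT
      by_cases he : N.Enabled μ₁ t
      · obtain ⟨v, hv⟩ := hS.exists_pre hp hpP
        have h2 := hz₂.2 p hp hpP v t hv hF
        have h3 := ((hen t ht hne).mp he).2 p hF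
        omega
      · have hex : ∃ q, N.F q t ∧ μ₁ q = 0 := by
          by_contra! hcon
          exact he ⟨htT, fun q hq => Nat.one_le_iff_ne_zero.mpr (hcon q hq)⟩
        obtain ⟨q, hq, h0⟩ := hex
        have hqS := hpre q hq
        have hqP := place_of_F_transition hq htT
        obtain ⟨v, hv⟩ := hS.exists_pre hqS hqP
        have h2 := hz₁.2 q hqS hqP v t hv hq
        have h3 := hz₂.2 q hqS hqP v t hv hq
        have h4 := ih v ⟨q, hqS, hqP, hv, hq⟩ (hS.mem_of_F' hqS hqP hv)
          (transition_of_F_place hv hqP)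
        omega
  have heq : ∀ t, t ∈ S → t ∈ N.transitions → z₁ t = z₂ t := fun t ht htT =>
    le_antisymm (hle h₁ hz₁ hz₂ hen t ht htT)
      (hle h₂ hz₂ hz₁ (fun t ht hne => (hen t ht hne).symm) t ht htT)
  obtain ⟨v, hv⟩ := hS.exists_pre hp hpP
  obtain ⟨u, hu⟩ := hS.exists_post hp hpP
  have h1 := hz₁.2 p hp hpP v u hv hu
  have h2 := hz₂.2 p hp hpP v u hv hu
  have h3 := heq v (hS.mem_of_F' hp hpP hv) (transition_of_F_place hv hpP)
  have h4 := heq u (hS.mem_of_F hp hpP hu) (transition_of_place_F hu hpP)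
  omega

end CPSubnet

/-- An occurrence sequence whose transitions have all their input places in `S` stays enabled
when the marking is changed outside `S`. -/
theorem FireSeq.exists_of_eq_on {S : Finset α} (h : N.FireSeq μ σ ν)
    (hσ : ∀ t ∈ σ, ∀ p, N.F p t → p ∈ S) {μ' : α → ℕ}
    (heq : ∀ p ∈ S, p ∈ N.places → μ p = μ' p) :
    ∃ ν', N.FireSeq μ' σ ν' ∧ ∀ p ∈ S, p ∈ N.places → ν p = ν' p := by
  induction h generalizing μ' with
  | nil => exact ⟨μ', .nil _, heq⟩
  | @cons μ ν t σ he _ ih =>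
    obtain ⟨ν', hν', h'⟩ := ih (fun u hu => hσ u (List.mem_cons_of_mem _ hu))
      (μ' := N.fire t μ') fun p hp hpP => by simp only [fire, heq p hp hpP]
    refine ⟨ν', .cons ⟨he.1, fun p hp => ?_⟩ hν', h'⟩
    rw [← heq p (hσ t List.mem_cons_self p hp) (place_of_F_transition hp he.1)]
    exact he.2 p hp

end Net

/-- **Common shutdown sequence.** Let `(N, μ₀)` be a perpetual free-choice
system with regeneration cluster `cl`, let `S` span a `cl`-adapted CP-subnet
with way-in transition `tin`, and let `μ₁, μ₂` be reachable markings whose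
restrictions to the subnet are enabling equivalent. Then every shutdown
sequence for the subnet at `μ₁` is also a shutdown sequence at `μ₂`. -/
theorem adapted_cpSubnet_common_shutdown
    {α : Type*} [DecidableEq α] (N : Net α) (μ₀ : α → ℕ) (cl : Set α)
    (hfc : N.FreeChoice) (hperp : N.Perpetual μ₀ cl)
    (S : Finset α) (hS : N.IsCPSubnet S) (had : ¬ cl ⊆ (S : Set α))
    (tin : α) (htin : N.IsWayIn S tin)
    (μ₁ μ₂ : α → ℕ) (h₁ : N.Reach μ₀ μ₁) (h₂ : N.Reach μ₀ μ₂)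
    (hen : (N.restrict S).en μ₁ = (N.restrict S).en μ₂)
    (σ : List α) (μ₁sd : α → ℕ) (hsd₁ : N.IsShutdownSeq S tin μ₁ σ μ₁sd) :
    ∃ μ₂sd : α → ℕ, N.IsShutdownSeq S tin μ₂ σ μ₂sd := by

  have hpre : ∀ t ∈ S, t ∈ N.transitions → t ≠ tin → ∀ p, N.F p t → p ∈ S :=
    fun t ht htT hne => (hS.pre_mem hfc hperp.1 hperp.2.1 htin ht htT hne).1
  have hiff : ∀ μ : α → ℕ, ∀ t ∈ S, t ≠ tin → ((N.restrict S).Enabled μ t ↔ N.Enabled μ t) := by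
    intro μ t ht hne
    constructor
    · rintro ⟨htT, h⟩
      have htT' := (Finset.mem_inter.mp htT).1
      exact ⟨htT', fun p hp => h p ⟨hpre t ht htT' hne p hp, ht, hp⟩⟩
    · rintro ⟨htT, h⟩
      exact ⟨Finset.mem_inter.mpr ⟨htT, ht⟩, fun p hp => h p hp.2.2⟩
  have heq : ∀ p ∈ S, p ∈ N.places → μ₁ p = μ₂ p := fun p hp hpP =>
    hperp.eq_on_of_enabled_iff hfc hS had htin h₁ h₂ (fun t ht hne => by
      rw [← hiff μ₁ t ht hne, ← hiff μ₂ t ht hne]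
      exact Set.ext_iff.mp hen t) hp hpP
  obtain ⟨hσ, hmem, hdead⟩ := hsd₁
  obtain ⟨ν, hν, hνeq⟩ := hσ.exists_of_eq_on
    (fun t ht => hpre t (hmem t ht).1 (hmem t ht).2.1 (hmem t ht).2.2) heq
  refine ⟨ν, hν, hmem, fun t ht htT hne he => hdead t ht htT hne ⟨htT, fun p hp => ?_⟩⟩
  rw [hνeq p (hpre t ht htT hne p hp) (Net.place_of_F_transition hp htT)]
  exact he.2 p hp
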